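/- The polynomial f = (x² + y² + z²)³ + (x³ + y³ + z³)² + z⁷ ∈ ℂ[x,y,z] has an isolated critical point at the origin, and its Milnor number is μ(f) = 137. -/

import Mathlib

open MvPolynomial

/-- The Milnor number of a polynomial `F ∈ ℂ[x,y,z]`: the `ℂ`-dimension of the quotient of the
formal power series ring `ℂ⟦x,y,z⟧` by the ideal generated by the three partial derivatives. -/
noncomputable def milnorNumber (F : MvPolynomial (Fin 3) ℂ) : ℕ :=
  Module.finrank ℂ (MvPowerSeries (Fin 3) ℂ ⧸
    Ideal.span (Set.range fun i : Fin 3 => (pderiv i F).toMvPowerSeries))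

/-- `F` has a critical point at the origin of `ℂ³`, and it is isolated. -/
def HasIsolatedCriticalPointAtOrigin (F : MvPolynomial (Fin 3) ℂ) : Prop :=
  (∀ i, eval (0 : Fin 3 → ℂ) (pderiv i F) = 0) ∧
  ∃ ε > (0 : ℝ), ∀ p : Fin 3 → ℂ, ‖p‖ < ε → (∀ i, eval p (pderiv i F) = 0) → p = 0

/-- The formal properties of the local intersection multiplicity at the origin of three surfaces
in affine 3-space: `P a b c n` is to be read as `i₀(a, b, c) = n`. -/
structure IsIntersectionMultiplicity
    (P : MvPolynomial (Fin 3) ℂ → MvPolynomial (Fin 3) ℂ → MvPolynomial (Fin 3) ℂ → ℕ → Prop) :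
    Prop where
  base : P (X 0) (X 1) (X 2) 1
  swap₁₂ {a b c n} : P a b c n → P b a c n
  swap₂₃ {a b c n} : P a b c n → P a c b n
  mul {a b c d m n} : P a b c m → P a b d n → P a b (c * d) (m + n)
  add {a b c n} (r s) : P a b c n → P a b (c + r * a + s * b) n
  unit_mul {a b c n u} : constantCoeff u ≠ 0 → (P a b (u * c) n ↔ P a b c n)

@[simp]
lemma MvPolynomial.constantCoeff_ofNat {σ R : Type*} [CommSemiring R] (n : ℕ) [n.AtLeastTwo] :
    constantCoeff (ofNat(n) : MvPolynomial σ R) = ofNat(n) :=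
  map_ofNat _ _

namespace IsIntersectionMultiplicity

variable {P : MvPolynomial (Fin 3) ℂ → MvPolynomial (Fin 3) ℂ → MvPolynomial (Fin 3) ℂ → ℕ → Prop}
  {a a' b b' c c' w y z F G e u v q s : MvPolynomial (Fin 3) ℂ} {k m n : ℕ}

lemma congr₃ (hP : IsIntersectionMultiplicity P) (r s : MvPolynomial (Fin 3) ℂ)
    (h : P a b c n) (hc : c' = c + r * a + s * b) : P a b c' n :=
  hc ▸ hP.add r s h

lemma congr₂ (hP : IsIntersectionMultiplicity P) (r s : MvPolynomial (Fin 3) ℂ)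
    (h : P a b c n) (hb : b' = b + r * a + s * c) : P a b' c n :=
  hP.swap₂₃ (hP.congr₃ r s (hP.swap₂₃ h) hb)

lemma swap₁₃ (hP : IsIntersectionMultiplicity P) (h : P a b c n) : P c b a n :=
  hP.swap₁₂ (hP.swap₂₃ (hP.swap₁₂ h))

lemma unit_mul₂ (hP : IsIntersectionMultiplicity P) (hu : constantCoeff u ≠ 0)
    (h : P a b c n) : P a (u * b) c n :=
  hP.swap₂₃ ((hP.unit_mul hu).2 (hP.swap₂₃ h))

lemma mul₂ (hP : IsIntersectionMultiplicity P) (h : P a b c m) (h' : P a b' c n) :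
    P a (b * b') c (m + n) :=
  hP.swap₂₃ (hP.mul (hP.swap₂₃ h) (hP.swap₂₃ h'))

lemma mul₁ (hP : IsIntersectionMultiplicity P) (h : P a b c m) (h' : P a' b c n) :
    P (a * a') b c (m + n) :=
  hP.swap₁₂ (hP.mul₂ (hP.swap₁₂ h) (hP.swap₁₂ h'))

lemma pow_succ (hP : IsIntersectionMultiplicity P) (h : P a b c n) (k : ℕ) :
    P a b (c ^ (k + 1)) ((k + 1) * n) := by
  induction k with
  | zero => simpa using h
  | succ k ih =>
    rw [_root_.pow_succ, add_mul (k + 1) 1 n, one_mul]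
    exact hP.mul ih h

lemma of_eq_unit_mul_pow_add (hP : IsIntersectionMultiplicity P) (h : P w y z 1)
    (hu : constantCoeff u ≠ 0) (hG : G = u * y ^ (k + 1) + z * s) : P w G z (k + 1) := by
  have h₁ := (hP.unit_mul hu).2 (hP.pow_succ (hP.swap₂₃ h) k)
  rw [mul_one] at h₁
  exact hP.swap₂₃ (hP.congr₃ 0 s h₁ (by rw [hG]; ring))

lemma euclid_step (hP : IsIntersectionMultiplicity P) (h : P w y z 1)
    (hu : constantCoeff u ≠ 0) (hv : constantCoeff v ≠ 0) (hc : constantCoeff c ≠ 0)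
    (hG : G = u * y ^ (k + 1) + z * s) (hF : v * F = q * G + c * z ^ (m + 1) * e)
    (hn : P w G e n) : P w F G (n + (m + 1) * (k + 1)) := by
  have h₁ := hP.pow_succ (hP.of_eq_unit_mul_pow_add h hu hG) m
  have h₂ := (hP.unit_mul hc).2 (hP.mul hn h₁)
  exact hP.swap₂₃ ((hP.unit_mul hv).1 (hP.congr₃ 0 q h₂ (by rw [hF]; ring)))

lemma euclid_unit (hP : IsIntersectionMultiplicity P) (h : P w y z 1)
    (hu : constantCoeff u ≠ 0) (hv : constantCoeff v ≠ 0) (he : constantCoeff e ≠ 0)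
    (hG : G = u * y ^ (k + 1) + z * s) (hF : v * F = q * G + z * e) : P w F G (k + 1) := by
  have h₁ := (hP.unit_mul he).2 (hP.of_eq_unit_mul_pow_add h hu hG)
  exact hP.swap₂₃ ((hP.unit_mul hv).1 (hP.congr₃ 0 q h₁ (by rw [hF]; ring)))

lemma euclid_boundary (hP : IsIntersectionMultiplicity P) {w y z : MvPolynomial (Fin 3) ℂ}
    (h : P w y z 1) (hy : constantCoeff y = 0) (hz : constantCoeff z = 0) :
    P w (2 * y ^ 4 + 2 * y ^ 2 * z ^ 2 + y * z ^ 3 + z ^ 4)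
      (6 * y ^ 4 + 6 * y ^ 3 * z + 12 * y ^ 2 * z ^ 2 + 12 * z ^ 4 + 7 * z ^ 5) 16 := by
  refine hP.euclid_step (m := 0) (k := 3) (c := 1) (u := 6)
    (s := 6 * y ^ 3 + 12 * y ^ 2 * z + 12 * z ^ 3 + 7 * z ^ 4)
    (v := 3) (q := 1)
    (e := -6 * y ^ 3 - 6 * y ^ 2 * z + 3 * y * z ^ 2 - 9 * z ^ 3 - 7 * z ^ 4)
    h (by simp) (by simp) (by simp) (by ring) (by ring) ?_
  refine hP.euclid_step (m := 1) (k := 2) (c := 1) (u := -6)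
    (s := -6 * y ^ 2 + 3 * y * z - 9 * z ^ 2 - 7 * z ^ 3)
    (v := -1) (q := y)
    (e := -15 * y ^ 2 + 9 * y * z - 12 * z ^ 2 + 7 * y * z ^ 2 - 7 * z ^ 3)
    h (by simp) (by simp) (by simp) (by ring) (by ring) ?_
  refine hP.euclid_step (m := 0) (k := 1) (c := 1) (u := -15)
    (s := 9 * y - 12 * z + 7 * y * z - 7 * z ^ 2)
    (v := -5) (q := -2 * y)
    (e := 48 * y ^ 2 - 39 * y * z + 45 * z ^ 2 + 14 * y ^ 2 * z - 14 * y * z ^ 2 + 35 * z ^ 3)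
    h (by simp) (by simp) (by simp) (by ring) (by ring) ?_
  refine hP.euclid_step (m := 0) (k := 1) (c := 1) (u := 48)
    (s := -39 * y + 45 * z + 14 * y ^ 2 - 14 * y * z + 35 * z ^ 2)
    (v := 16) (q := -5)
    (e := -51 * y + 33 * z + 70 * y ^ 2 + 42 * y * z + 63 * z ^ 2)
    h (by simp) (by simp) (by simp) (by ring) (by ring) ?_
  refine hP.euclid_step (m := 0) (k := 0) (c := 16) (u := 33 + 63 * z)
    (s := -51 + 70 * y + 42 * z)
    (v := 33 + 63 * z) (q := 45 * z + 35 * z ^ 2)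
    (e := 99 * y + 63 * z + 21 * y * z - 189 * z ^ 2 - 98 * y * z ^ 2 - 147 * z ^ 3)
    (hP.swap₂₃ h) (by simp [hz]) (by simp [hz]) (by simp) (by ring) (by ring) ?_
  refine hP.euclid_unit (u := 99)
    (s := 63 + 21 * y - 189 * z - 98 * y * z - 147 * z ^ 2)
    (v := 99) (q := -51 + 70 * y)
    (e := 6480 + 819 * y - 3402 * z - 1470 * y ^ 2 + 8232 * y * z
      - 7497 * z ^ 2 + 6860 * y ^ 2 * z + 10290 * y * z ^ 2)
    h (by simp) (by simp) (by simp [hy, hz]) (by ring) (by ring)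

lemma euclid_diagonal (hP : IsIntersectionMultiplicity P) {w y z : MvPolynomial (Fin 3) ℂ}
    (h : P w y z 1) (hy : constantCoeff y = 0) (hz : constantCoeff z = 0) :
    P w (6 * y ^ 4 + 4 * y ^ 2 * z ^ 2 + y * z ^ 3 + z ^ 4)
      (24 * y ^ 4 + 12 * y ^ 3 * z + 24 * y ^ 2 * z ^ 2 + 12 * z ^ 4 + 7 * z ^ 5) 16 := by
  refine hP.euclid_step (m := 0) (k := 3) (c := 1) (u := 24)
    (s := 12 * y ^ 3 + 24 * y ^ 2 * z + 12 * z ^ 3 + 7 * z ^ 4)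
    (v := 4) (q := 1)
    (e := -12 * y ^ 3 - 8 * y ^ 2 * z + 4 * y * z ^ 2 - 8 * z ^ 3 - 7 * z ^ 4)
    h (by simp) (by simp) (by simp) (by ring) (by ring) ?_
  refine hP.euclid_step (m := 0) (k := 2) (c := 1) (u := -12)
    (s := -8 * y ^ 2 + 4 * y * z - 8 * z ^ 2 - 7 * z ^ 3)
    (v := -1) (q := 2 * y)
    (e := 4 * y ^ 3 - 32 * y ^ 2 * z + 16 * y * z ^ 2 - 12 * z ^ 3 + 14 * y * z ^ 3 - 7 * z ^ 4)
    h (by simp) (by simp) (by simp) (by ring) (by ring) ?_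
  refine hP.euclid_step (m := 0) (k := 2) (c := 2) (u := 4)
    (s := -32 * y ^ 2 + 16 * y * z - 12 * z ^ 2 + 14 * y * z ^ 2 - 7 * z ^ 3)
    (v := 1) (q := -3)
    (e := -52 * y ^ 2 + 26 * y * z - 22 * z ^ 2 + 21 * y * z ^ 2 - 14 * z ^ 3)
    h (by simp) (by simp) (by simp) (by ring) (by ring) ?_
  refine hP.euclid_step (m := 0) (k := 1) (c := 1) (u := -52)
    (s := 26 * y - 22 * z + 21 * y * z - 14 * z ^ 2)
    (v := -13) (q := y)
    (e := 390 * y ^ 2 - 186 * y * z + 156 * z ^ 2 - 21 * y ^ 2 * z - 168 * y * z ^ 2 + 91 * z ^ 3)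
    h (by simp) (by simp) (by simp) (by ring) (by ring) ?_
  refine hP.euclid_step (m := 0) (k := 1) (c := 1) (u := 390)
    (s := -186 * y + 156 * z - 21 * y ^ 2 - 168 * y * z + 91 * z ^ 2)
    (v := 15) (q := -2)
    (e := 18 * y - 18 * z - 42 * y ^ 2 - 21 * y * z - 28 * z ^ 2)
    h (by simp) (by simp) (by simp) (by ring) (by ring) ?_
  refine hP.euclid_step (m := 0) (k := 0) (c := 15) (u := -18 - 28 * z)
    (s := 18 - 42 * y - 21 * z)
    (v := -18 - 28 * z) (q := 156 * z + 91 * z ^ 2)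
    (e := -468 * y + 36 * z - 266 * y * z + 658 * z ^ 2 + 294 * y * z ^ 2 + 441 * z ^ 3)
    (hP.swap₂₃ h) (by simp [hz]) (by simp [hz]) (by simp) (by ring) (by ring) ?_
  refine hP.euclid_unit (u := -468)
    (s := 36 - 266 * y + 658 * z + 294 * y * z + 441 * z ^ 2)
    (v := -78) (q := 3 - 7 * y)
    (e := 1296 + 2688 * y + 210 * z - 1862 * y ^ 2 + 3724 * y * z
      - 1323 * z ^ 2 + 2058 * y ^ 2 * z + 3087 * y * z ^ 2)
    h (by simp) (by simp) (by simp [hy, hz]) (by ring) (by ring)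

lemma apply_gradient (hP : IsIntersectionMultiplicity P) :
    P (6 * (X 0 * ((X 0 ^ 2 + X 1 ^ 2 + X 2 ^ 2) ^ 2 + X 0 * (X 0 ^ 3 + X 1 ^ 3 + X 2 ^ 3))))
      (6 * (X 1 * ((X 0 ^ 2 + X 1 ^ 2 + X 2 ^ 2) ^ 2 + X 1 * (X 0 ^ 3 + X 1 ^ 3 + X 2 ^ 3))))
      (X 2 * (6 * (X 0 ^ 2 + X 1 ^ 2 + X 2 ^ 2) ^ 2 + 6 * X 2 * (X 0 ^ 3 + X 1 ^ 3 + X 2 ^ 3)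
        + 7 * X 2 ^ 5)) 137 := by
  have hx : constantCoeff (X 0 : MvPolynomial (Fin 3) ℂ) = 0 := by simp
  have hy : constantCoeff (X 1 : MvPolynomial (Fin 3) ℂ) = 0 := by simp
  have hz : constantCoeff (X 2 : MvPolynomial (Fin 3) ℂ) = 0 := by simp
  have xyz := hP.base
  generalize (X 0 : MvPolynomial (Fin 3) ℂ) = x at *
  generalize (X 1 : MvPolynomial (Fin 3) ℂ) = y at *
  generalize (X 2 : MvPolynomial (Fin 3) ℂ) = z at *
  obtain ⟨p, hp⟩ : ∃ p, p = x ^ 2 + y ^ 2 + z ^ 2 := ⟨_, rfl⟩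
  obtain ⟨q, hq⟩ : ∃ q, q = x ^ 3 + y ^ 3 + z ^ 3 := ⟨_, rfl⟩
  rw [← hp, ← hq]
  obtain ⟨A, hA⟩ : ∃ A, A = p ^ 2 + x * q := ⟨_, rfl⟩
  obtain ⟨B, hB⟩ : ∃ B, B = p ^ 2 + y * q := ⟨_, rfl⟩
  obtain ⟨C, hC⟩ : ∃ C, C = 6 * p ^ 2 + 6 * z * q + 7 * z ^ 5 := ⟨_, rfl⟩
  rw [← hA, ← hB, ← hC]
  have yxz := hP.swap₁₂ xyz
  have dxz : P (x - y) x z 1 := by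
    have h₁ : P y (x - y) z 1 := hP.congr₂ (-1) 0 yxz (by ring)
    exact hP.congr₂ 1 0 (hP.swap₁₂ h₁) (by ring)
  have xyC : P x y C 4 :=
    hP.congr₃ (6 * x * (p + y ^ 2 + z ^ 2) + 6 * z * x ^ 2)
      (6 * y * (y ^ 2 + 2 * z ^ 2) + 6 * z * y ^ 2)
      ((hP.unit_mul (u := 12 + 7 * z) (by simp [hz])).2 (hP.pow_succ xyz 3))
      (by rw [hC, hp, hq]; ring)
  have xBz : P x B z 4 :=
    hP.congr₂ (x * (p + y ^ 2 + z ^ 2) + y * x ^ 2) (z * (z ^ 2 + 2 * y ^ 2) + z ^ 2 * y)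
      (hP.swap₂₃ ((hP.unit_mul (u := 2) (by simp)).2 (hP.pow_succ (hP.swap₂₃ xyz) 3)))
      (by rw [hB, hp, hq]; ring)
  have Ayz : P A y z 4 :=
    hP.swap₁₂ (hP.congr₂ (y * (p + x ^ 2 + z ^ 2) + x * y ^ 2) (z * (z ^ 2 + 2 * x ^ 2) + z ^ 2 * x)
      (hP.swap₂₃ ((hP.unit_mul (u := 2) (by simp)).2 (hP.pow_succ (hP.swap₂₃ yxz) 3)))
      (by rw [hA, hp, hq]; ring))
  have xBC : P x B C 16 :=
    hP.congr₃ (6 * x * (p + y ^ 2 + z ^ 2) + 6 * z * x ^ 2) 0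
      (hP.congr₂ (x * (p + y ^ 2 + z ^ 2) + y * x ^ 2) 0 (hP.euclid_boundary xyz hy hz)
        (by rw [hB, hp, hq]; ring))
      (by rw [hC, hp, hq]; ring)
  have AyC : P A y C 16 :=
    hP.swap₁₂ (hP.congr₃ (6 * y * (p + x ^ 2 + z ^ 2) + 6 * z * y ^ 2) 0
      (hP.congr₂ (y * (p + x ^ 2 + z ^ 2) + x * y ^ 2) 0 (hP.euclid_boundary yxz hx hz)
        (by rw [hA, hp, hq]; ring))
      (by rw [hC, hp, hq]; ring))
  have AdC : P A (x - y) C 16 :=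
    hP.swap₁₂ (hP.congr₃
      (-6 * (x + y) * (p + 2 * x ^ 2 + z ^ 2) - 6 * z * (x ^ 2 + x * y + y ^ 2)) 0
      (hP.congr₂ (-(x + y) * (p + 2 * x ^ 2 + z ^ 2) - x * (x ^ 2 + x * y + y ^ 2)) 0
        (hP.euclid_diagonal dxz hx hz)
        (by rw [hA, hp, hq]; ring))
      (by rw [hC, hp, hq]; ring))
  have Adz : P A (x - y) z 4 :=
    hP.swap₁₂ (hP.congr₂ (-(x + y) * (p + 2 * x ^ 2 + z ^ 2) - x * (x ^ 2 + x * y + y ^ 2))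
      (z * (z ^ 2 + 4 * x ^ 2) + z ^ 2 * x)
      (hP.swap₂₃ ((hP.unit_mul (u := 6) (by simp)).2 (hP.pow_succ (hP.swap₂₃ dxz) 3)))
      (by rw [hA, hp, hq]; ring))
  have pqz : P p q z 6 := by
    have h₁ : P z (x ^ 2 + y ^ 2) y 2 :=
      hP.swap₂₃ (hP.congr₃ 0 y (hP.pow_succ (hP.swap₁₃ xyz) 1) (by ring))
    have h₂ : P z (x ^ 2 + y ^ 2) (x - y) 2 :=
      hP.swap₂₃ (hP.congr₃ 0 (-(x + y)) ((hP.unit_mul (u := 2) (by simp)).2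
        (hP.pow_succ (hP.swap₁₃ (hP.swap₁₂ dxz)) 1)) (by ring))
    have h₃ : P z (x ^ 2 + y ^ 2) (-1 * (y ^ 2 * (x - y))) 6 :=
      (hP.unit_mul (by simp)).2 (hP.mul (hP.pow_succ h₁ 1) h₂)
    have h₄ : P z p q 6 :=
      hP.congr₃ (z ^ 2 - x * z) x (hP.congr₂ z 0 h₃ (by rw [hp]; ring)) (by rw [hp, hq]; ring)
    exact hP.swap₁₂ (hP.swap₁₃ h₄)
  have ABz : P A B z 16 := by
    have h₁ : P (p ^ 2) q z 12 := hP.swap₁₃ (hP.pow_succ (hP.swap₁₃ pqz) 1)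
    have h₂ : P A q z 12 := hP.swap₁₂ (hP.congr₂ x 0 (hP.swap₁₂ h₁) (by rw [hA]; ring))
    exact hP.congr₂ 1 0 (hP.unit_mul₂ (u := -1) (by simp) (hP.mul₂ Adz h₂)) (by rw [hA, hB]; ring)
  have ABC : P A B C 76 := by
    have h₁ : P p q C 30 :=
      hP.congr₃ (6 * p) (6 * z) ((hP.unit_mul (u := 7) (by simp)).2 (hP.pow_succ pqz 4))
        (by rw [hC]; ring)
    have h₂ : P (p ^ 2) q C 60 := hP.swap₁₃ (hP.pow_succ (hP.swap₁₃ h₁) 1)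
    have h₃ : P A q C 60 := hP.swap₁₂ (hP.congr₂ x 0 (hP.swap₁₂ h₂) (by rw [hA]; ring))
    exact hP.congr₂ 1 0 (hP.unit_mul₂ (u := -1) (by simp) (hP.mul₂ AdC h₃)) (by rw [hA, hB]; ring)
  refine hP.swap₁₂ (hP.unit_mul₂ (by simp) (hP.swap₁₂ (hP.unit_mul₂ (by simp) ?_)))
  exact hP.mul₁ (hP.mul₂ (hP.mul xyz xyC) (hP.mul xBz xBC))
    (hP.mul₂ (hP.mul Ayz AyC) (hP.mul ABz ABC))

end IsIntersectionMultiplicity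

section LocalRing

open IsLocalRing RingTheory.Sequence

variable {S : Type*} [CommRing S]

lemma isWeaklyRegular_append_singleton_iff (rs : List S) (c : S) :
    IsWeaklyRegular S (rs ++ [c]) ↔
      IsWeaklyRegular S rs ∧ ∀ r, c * r ∈ Ideal.ofList rs → r ∈ Ideal.ofList rs := by
  rw [isWeaklyRegular_append_iff, isWeaklyRegular_singleton_iff,
    isSMulRegular_quotient_iff_mem_of_smul_mem]
  simp

lemma Ideal.sup_span_singleton_add_eq {I : Ideal S} {i : S} (hi : i ∈ I) (c : S) :
    I ⊔ Ideal.span {c + i} = I ⊔ Ideal.span {c} := by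
  refine le_antisymm (sup_le le_sup_left ?_) (sup_le le_sup_left ?_) <;>
    rw [Ideal.span_singleton_le_iff_mem]
  · exact add_mem (Ideal.mem_sup_right (Ideal.mem_span_singleton_self c)) (Ideal.mem_sup_left hi)
  · have := sub_mem (Ideal.mem_sup_right (Ideal.mem_span_singleton_self (c + i)))
      (Ideal.mem_sup_left (T := Ideal.span {c + i}) hi)
    rwa [add_sub_cancel_right] at this

lemma length_quotient_sup_span_singleton_mul (K : Type*) [CommRing K] [Algebra K S] {I : Ideal S}
    {c : S} (hc : ∀ r, c * r ∈ I → r ∈ I) (d : S) :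
    Module.length K (S ⧸ I ⊔ Ideal.span {c * d}) =
      Module.length K (S ⧸ I ⊔ Ideal.span {c}) + Module.length K (S ⧸ I ⊔ Ideal.span {d}) := by
  have hf : I ⊔ Ideal.span {d} ≤
      Submodule.comap (LinearMap.mulLeft S c) (I ⊔ Ideal.span {c * d}) := by
    refine sup_le (fun i hi => ?_) ?_
    · exact Ideal.mem_sup_left (I.mul_mem_left c hi)
    · rw [Ideal.span_singleton_le_iff_mem]
      exact Ideal.mem_sup_right (Ideal.mem_span_singleton_self _)
  have hg : I ⊔ Ideal.span {c * d} ≤ I ⊔ Ideal.span {c} :=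
    sup_le_sup_left (Ideal.span_singleton_le_span_singleton.2 (dvd_mul_right c d)) I
  rw [add_comm]
  refine Module.length_eq_add_of_exact
    ((Submodule.mapQ _ _ (LinearMap.mulLeft S c) hf).restrictScalars K)
    ((Submodule.factor hg).restrictScalars K) ?_ (Submodule.factor_surjective hg) ?_
  · refine (injective_iff_map_eq_zero _).2 fun x => ?_
    obtain ⟨r, rfl⟩ := Submodule.mkQ_surjective _ x
    simp only [LinearMap.restrictScalars_apply, Submodule.mkQ_apply, Submodule.mapQ_apply,
      LinearMap.mulLeft_apply, Submodule.Quotient.mk_eq_zero]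
    intro h
    obtain ⟨i, hi, t, ht, hit⟩ := Submodule.mem_sup.1 h
    obtain ⟨s, rfl⟩ := Ideal.mem_span_singleton'.1 ht
    have : r - s * d ∈ I := hc _ (by convert hi using 1; linear_combination -hit)
    rw [← sub_add_cancel r (s * d)]
    exact add_mem (Ideal.mem_sup_left this)
      (Ideal.mem_sup_right (Ideal.mul_mem_left _ _ (Ideal.mem_span_singleton_self d)))
  · intro x
    obtain ⟨r, rfl⟩ := Submodule.mkQ_surjective _ x
    have hgr : Submodule.factor hg (Submodule.Quotient.mk r) = 0 ↔ r ∈ I ⊔ Ideal.span {c} :=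
      Submodule.Quotient.mk_eq_zero _
    refine hgr.trans ⟨?_, ?_⟩
    · intro h
      obtain ⟨i, hi, t, ht, rfl⟩ := Submodule.mem_sup.1 h
      obtain ⟨s, rfl⟩ := Ideal.mem_span_singleton'.1 ht
      refine ⟨Submodule.Quotient.mk s, ?_⟩
      simp only [LinearMap.restrictScalars_apply, Submodule.mapQ_apply, LinearMap.mulLeft_apply]
      refine (Submodule.Quotient.eq _).2 (Ideal.mem_sup_left ?_)
      convert neg_mem hi using 1
      ring
    · rintro ⟨y, hy⟩
      obtain ⟨s, rfl⟩ := Submodule.mkQ_surjective _ y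
      simp only [LinearMap.restrictScalars_apply, Submodule.mkQ_apply, Submodule.mapQ_apply,
        LinearMap.mulLeft_apply] at hy
      replace hy := (Submodule.Quotient.eq _).1 hy
      rw [← sub_sub_cancel (c * s) r]
      exact sub_mem (Ideal.mem_sup_right (Ideal.mul_mem_right _ _
        (Ideal.mem_span_singleton_self c))) (hg hy)

lemma Ideal.ofList_triple (a b c : S) :
    Ideal.ofList [a, b, c] = Ideal.ofList [a, b] ⊔ Ideal.span {c} := by
  rw [← Ideal.ofList_singleton, ← Ideal.ofList_append]; rfl

/-- `a, b, c` is a regular sequence in the maximal ideal of the local `K`-algebra `S`, whose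
quotient has length `n` over `K`. -/
structure IsRegularTripleOfLength (K : Type*) [CommRing K] [Algebra K S] [IsLocalRing S]
    (a b c : S) (n : ℕ) : Prop where
  isWeaklyRegular : IsWeaklyRegular S [a, b, c]
  mem_maximalIdeal : ∀ r ∈ [a, b, c], r ∈ maximalIdeal S
  length_eq : Module.length K (S ⧸ Ideal.ofList [a, b, c]) = n

namespace IsRegularTripleOfLength

variable {K : Type*} [CommRing K] [Algebra K S] [IsLocalRing S] {a b c d u : S} {m n : ℕ}

lemma perm [IsNoetherianRing S] {a' b' c' : S} (h : IsRegularTripleOfLength K a b c n)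
    (hp : [a, b, c].Perm [a', b', c']) : IsRegularTripleOfLength K a' b' c' n where
  isWeaklyRegular :=
    isWeaklyRegular_of_perm_of_subset_maximalIdeal h.isWeaklyRegular hp h.mem_maximalIdeal
  mem_maximalIdeal r hr := h.mem_maximalIdeal r (hp.mem_iff.2 hr)
  length_eq := by
    have : Ideal.ofList [a', b', c'] = Ideal.ofList [a, b, c] :=
      congrArg Ideal.span (Set.ext fun _ => hp.mem_iff.symm)
    rw [this, h.length_eq]

lemma iff_sup : IsRegularTripleOfLength K a b c n ↔
    (IsWeaklyRegular S [a, b] ∧ a ∈ maximalIdeal S ∧ b ∈ maximalIdeal S) ∧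
      (∀ r, c * r ∈ Ideal.ofList [a, b] → r ∈ Ideal.ofList [a, b]) ∧ c ∈ maximalIdeal S ∧
      Module.length K (S ⧸ Ideal.ofList [a, b] ⊔ Ideal.span {c}) = n := by
  have := isWeaklyRegular_append_singleton_iff [a, b] c
  rw [List.cons_append, List.cons_append, List.nil_append] at this
  constructor
  · rintro ⟨h₁, h₂, h₃⟩
    rw [Ideal.ofList_triple] at h₃
    exact ⟨⟨(this.1 h₁).1, h₂ a (by simp), h₂ b (by simp)⟩, (this.1 h₁).2, h₂ c (by simp), h₃⟩
  · rintro ⟨⟨h₁, ha, hb⟩, h₂, hc, h₃⟩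
    rw [← Ideal.ofList_triple] at h₃
    exact ⟨this.2 ⟨h₁, h₂⟩, by simpa using ⟨ha, hb, hc⟩, h₃⟩

lemma mul (h : IsRegularTripleOfLength K a b c m) (h' : IsRegularTripleOfLength K a b d n) :
    IsRegularTripleOfLength K a b (c * d) (m + n) := by
  rw [iff_sup] at h h' ⊢
  obtain ⟨hab, h₁, h₂, h₃⟩ := h
  obtain ⟨-, h₁', -, h₃'⟩ := h'
  refine ⟨hab, fun r hr => h₁' r (h₁ _ (by rwa [← mul_assoc])), Ideal.mul_mem_right _ _ h₂, ?_⟩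
  rw [length_quotient_sup_span_singleton_mul K h₁, h₃, h₃', Nat.cast_add]

lemma add (h : IsRegularTripleOfLength K a b c n) (r s : S) :
    IsRegularTripleOfLength K a b (c + r * a + s * b) n := by
  have hi : r * a + s * b ∈ Ideal.ofList [a, b] :=
    add_mem (Ideal.mul_mem_left _ _ (Ideal.subset_span (by simp)))
      (Ideal.mul_mem_left _ _ (Ideal.subset_span (by simp)))
  rw [iff_sup] at h ⊢
  obtain ⟨⟨hab, ha, hb⟩, h₁, h₂, h₃⟩ := h
  rw [add_assoc]
  refine ⟨⟨hab, ha, hb⟩, fun t ht => h₁ t ?_, ?_, ?_⟩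
  · have := sub_mem ht (Ideal.mul_mem_right t _ hi)
    rwa [add_mul, add_sub_cancel_right] at this
  · exact add_mem h₂ (add_mem (Ideal.mul_mem_left _ _ ha) (Ideal.mul_mem_left _ _ hb))
  · rw [Ideal.sup_span_singleton_add_eq hi, h₃]

lemma unit_mul_iff (hu : IsUnit u) :
    IsRegularTripleOfLength K a b (u * c) n ↔ IsRegularTripleOfLength K a b c n := by
  simp only [iff_sup, mul_assoc, Ideal.unit_mul_mem_iff_mem _ hu]
  rw [Ideal.span_singleton_mul_left_unit hu]

end IsRegularTripleOfLength

end LocalRing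

namespace MvPowerSeries

variable {σ R : Type*} [CommRing R]

lemma mem_ofList_map_X_iff [DecidableEq σ] (l : List σ) (φ : MvPowerSeries σ R) :
    φ ∈ Ideal.ofList (l.map X) ↔ ∀ m : σ →₀ ℕ, (∀ i ∈ l, m i = 0) → coeff m φ = 0 := by
  induction l generalizing φ with
  | nil =>
    simp [MvPowerSeries.ext_iff]
  | cons i l ih =>
    rw [List.map_cons, Ideal.ofList_cons]
    constructor
    · intro h m hm
      obtain ⟨p, hp, q, hq, rfl⟩ := Submodule.mem_sup.1 h
      rw [map_add, X_dvd_iff.1 (Ideal.mem_span_singleton.1 hp) m (hm i (by simp)),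
        (ih q).1 hq m fun j hj => hm j (by simp [hj]), add_zero]
    · intro h
      let ψ : MvPowerSeries σ R := fun m => if m i = 0 then 0 else coeff m φ
      have hψ (m : σ →₀ ℕ) : coeff m ψ = if m i = 0 then 0 else coeff m φ := rfl
      rw [← add_sub_cancel ψ φ]
      refine add_mem (Ideal.mem_sup_left ?_) (Ideal.mem_sup_right ?_)
      · rw [Ideal.mem_span_singleton, X_dvd_iff]
        intro m hm
        rw [hψ, if_pos hm]
      · rw [ih]
        intro m hm
        rw [map_sub, hψ]
        split_ifs with hi
        · rw [h m (by simpa [hi] using hm), sub_zero]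
        · exact sub_self _

lemma isWeaklyRegular_map_X [DecidableEq σ] (l : List σ) (hl : l.Nodup) :
    RingTheory.Sequence.IsWeaklyRegular (MvPowerSeries σ R)
      (l.map (X : σ → MvPowerSeries σ R)) := by
  induction l using List.reverseRecOn with
  | nil => exact .nil _ _
  | append_singleton l i ih =>
    rw [List.map_append, List.map_singleton, isWeaklyRegular_append_singleton_iff]
    rw [List.nodup_append] at hl
    refine ⟨ih hl.1, fun φ hφ => ?_⟩
    rw [mem_ofList_map_X_iff] at hφ ⊢
    intro m hm
    have h := hφ (Finsupp.single i 1 + m) fun j hj => by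
      have : i ≠ j := fun h => hl.2.2 j hj i (by simp) h.symm
      simp [hm j hj, this]
    rwa [X_def, coeff_add_monomial_mul, one_mul] at h

lemma isRegularTripleOfLength_X :
    IsRegularTripleOfLength ℂ (X 0 : MvPowerSeries (Fin 3) ℂ) (X 1) (X 2) 1 where
  isWeaklyRegular := isWeaklyRegular_map_X [0, 1, 2] (by decide)
  mem_maximalIdeal := by
    simp [isUnit_iff_constantCoeff]
  length_eq := by
    have hker : (Ideal.ofList [(X 0 : MvPowerSeries (Fin 3) ℂ), X 1, X 2]).restrictScalars ℂ =
        LinearMap.ker (coeff (R := ℂ) (0 : Fin 3 →₀ ℕ)) := by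
      ext φ
      have hz (m : Fin 3 →₀ ℕ) : (∀ i ∈ [(0 : Fin 3), 1, 2], m i = 0) ↔ m = 0 := by
        simp [Finsupp.ext_iff, Fin.forall_fin_succ]
      have h := mem_ofList_map_X_iff [(0 : Fin 3), 1, 2] φ
      simp only [hz, forall_eq] at h
      exact h
    have hsurj : Function.Surjective (coeff (R := ℂ) (0 : Fin 3 →₀ ℕ)) := fun r =>
      ⟨C r, by simp⟩
    rw [((Submodule.Quotient.restrictScalarsEquiv ℂ _).symm.trans
      ((Submodule.quotEquivOfEq _ _ hker).trans
        (LinearMap.quotKerEquivOfSurjective _ hsurj))).length_eq]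
    simp

end MvPowerSeries

lemma isIntersectionMultiplicity_powerSeries :
    IsIntersectionMultiplicity fun a b c n =>
      IsRegularTripleOfLength ℂ (a : MvPowerSeries (Fin 3) ℂ) b c n where
  base := by simpa only [MvPolynomial.coe_X] using MvPowerSeries.isRegularTripleOfLength_X
  swap₁₂ h := h.perm (.swap _ _ _)
  swap₂₃ h := h.perm (.cons _ (.swap _ _ _))
  mul h h' := by simpa only [MvPolynomial.coe_mul] using h.mul h'
  add r s h := by simpa only [MvPolynomial.coe_mul, MvPolynomial.coe_add] using h.add _ _
  unit_mul {a b c n u} hu := by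
    rw [MvPolynomial.coe_mul, IsRegularTripleOfLength.unit_mul_iff]
    rw [MvPowerSeries.isUnit_iff_constantCoeff, isUnit_iff_ne_zero,
      ← MvPowerSeries.coeff_zero_eq_constantCoeff_apply, MvPolynomial.coeff_coe]
    exact hu

open Topology in
lemma isIntersectionMultiplicity_isolated :
    IsIntersectionMultiplicity fun a b c _ =>
      ∀ᶠ p : Fin 3 → ℂ in 𝓝 0, eval p a = 0 → eval p b = 0 → eval p c = 0 → p = 0 where
  base := .of_forall fun p h₀ h₁ h₂ => by
    rw [eval_X] at h₀ h₁ h₂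
    ext i
    fin_cases i
    exacts [h₀, h₁, h₂]
  swap₁₂ h := h.mono fun p hp ha hb => hp hb ha
  swap₂₃ h := h.mono fun p hp ha hb hc => hp ha hc hb
  mul h h' := by
    filter_upwards [h, h'] with p hp hp' ha hb hcd
    rw [map_mul, mul_eq_zero] at hcd
    exact hcd.elim (hp ha hb) (hp' ha hb)
  add r s h := h.mono fun p hp ha hb hc => hp ha hb (by simpa [ha, hb] using hc)
  unit_mul {a b c n u} hu := by
    have : ∀ᶠ p : Fin 3 → ℂ in 𝓝 0, eval p u ≠ 0 :=
      (MvPolynomial.continuous_eval u).continuousAt.eventually_ne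
        (by rwa [MvPolynomial.eval_zero])
    refine Filter.eventually_congr (this.mono fun p hp => ?_)
    simp [hp]

theorem milnor_number_torus_sextic_isolation
    (f : MvPolynomial (Fin 3) ℂ)
    (hf : f = (X 0 ^ 2 + X 1 ^ 2 + X 2 ^ 2) ^ 3 + (X 0 ^ 3 + X 1 ^ 3 + X 2 ^ 3) ^ 2 + X 2 ^ 7) :
    HasIsolatedCriticalPointAtOrigin f ∧ milnorNumber f = 137 := by
  have h₀ : pderiv 0 f = 6 * (X 0 * ((X 0 ^ 2 + X 1 ^ 2 + X 2 ^ 2) ^ 2 +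
      X 0 * (X 0 ^ 3 + X 1 ^ 3 + X 2 ^ 3))) := by
    simp [hf, pderiv_X, Derivation.leibniz_pow]
    ring
  have h₁ : pderiv 1 f = 6 * (X 1 * ((X 0 ^ 2 + X 1 ^ 2 + X 2 ^ 2) ^ 2 +
      X 1 * (X 0 ^ 3 + X 1 ^ 3 + X 2 ^ 3))) := by
    simp [hf, pderiv_X, Derivation.leibniz_pow]
    ring
  have h₂ : pderiv 2 f = X 2 * (6 * (X 0 ^ 2 + X 1 ^ 2 + X 2 ^ 2) ^ 2 +
      6 * X 2 * (X 0 ^ 3 + X 1 ^ 3 + X 2 ^ 3) + 7 * X 2 ^ 5) := by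
    simp [hf, pderiv_X, Derivation.leibniz_pow]
    ring
  refine ⟨⟨?_, ?_⟩, ?_⟩
  · simp [Fin.forall_fin_succ, h₀, h₁, h₂]
  · have h := isIntersectionMultiplicity_isolated.apply_gradient
    rw [← h₀, ← h₁, ← h₂, Metric.eventually_nhds_iff] at h
    obtain ⟨ε, hε, h⟩ := h
    exact ⟨ε, hε, fun p hp hcrit => h (by rwa [dist_zero_right]) (hcrit 0) (hcrit 1) (hcrit 2)⟩
  · have h := isIntersectionMultiplicity_powerSeries.apply_gradient
    rw [← h₀, ← h₁, ← h₂] at h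
    have hI : Ideal.span (Set.range fun i : Fin 3 => (pderiv i f).toMvPowerSeries) =
        Ideal.ofList [(pderiv 0 f).toMvPowerSeries, (pderiv 1 f).toMvPowerSeries,
          (pderiv 2 f).toMvPowerSeries] := by
      refine congrArg Ideal.span (Set.ext fun g => ?_)
      simp [Fin.exists_fin_succ, eq_comm]
    have hl := h.length_eq
    rw [Module.length_eq_rank] at hl
    rw [milnorNumber, hI, Module.finrank, ← Cardinal.toNat_toENat, hl, ENat.toNat_natCast]
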